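/- Square of the Capelli element coefficients: Let n ≥ 1 and take λ = μ = (1^n) (the column partition with n parts equal to 1). Then f^ν_{λμ} = 0 for every partition ν with at most n parts that is not of the form ν = (2^r 1^{n−r}) for some 0 ≤ r ≤ n, and f^{(2^r 1^{n−r})}_{(1^n)(1^n)} = (n−r)! for every 0 ≤ r ≤ n. -/

import Mathlib

open scoped BigOperators

namespace FactorialLR

/-- Column order on cells: right-most column first, top to bottom within a column. -/
def ColLT (a b : ℕ × ℕ) : Prop :=
  b.2 < a.2 ∨ (a.2 = b.2 ∧ a.1 < b.1)

instance (a b : ℕ × ℕ) : Decidable (ColLT a b) := by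
  unfold ColLT; infer_instance

/-- A filling of the cell set `s` with entries in `Fin n` (`0`-based, representing the
`1`-based entries `{1,…,n}`) is semistandard if it weakly increases along rows and strictly
increases down columns. -/
def IsSsyt {n : ℕ} (s : Finset (ℕ × ℕ)) (T : s → Fin n) : Prop :=
  (∀ c c' : s, (c : ℕ × ℕ).1 = (c' : ℕ × ℕ).1 → (c : ℕ × ℕ).2 ≤ (c' : ℕ × ℕ).2 → T c ≤ T c') ∧
  (∀ c c' : s, (c : ℕ × ℕ).1 < (c' : ℕ × ℕ).1 → (c : ℕ × ℕ).2 = (c' : ℕ × ℕ).2 → T c < T c')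

/-- `μ → ν` : `ν` is obtained from `μ` by adding a single cell. -/
def Covers (μ ν : YoungDiagram) : Prop :=
  μ ≤ ν ∧ ν.card = μ.card + 1

/-- Chains `μ = ρ⁽⁰⁾ → ρ⁽¹⁾ → ⋯ → ρ⁽ˡ⁾ = ν` of Young diagrams, encoded as lists. -/
def chainSet (μ ν : YoungDiagram) : Set (List YoungDiagram) :=
  {L | L.Chain' Covers ∧ L.head? = some μ ∧ L.getLast? = some ν}

/-- The row (`0`-based) of the unique cell of `τ / σ`, when `σ → τ`. -/
def stepRow (σ τ : YoungDiagram) : ℕ :=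
  (τ.cells \ σ.cells).sup Prod.fst

/-- The set `𝒯(θ,R)` for a sequence `R` (encoded as the list `L`): pairs `(T,β)` where `T`
is a semistandard filling of `s` and `β` lists the barred cells `α_1 < ⋯ < α_l` in column
order, with `T(α_i) = r_i` (the row of `ρ⁽ⁱ⁾/ρ⁽ⁱ⁻¹⁾`). -/
def TSet {n : ℕ} (s : Finset (ℕ × ℕ)) (L : List YoungDiagram) :
    Set ((s → Fin n) × (Fin (L.length - 1) → s)) :=
  {p | IsSsyt s p.1 ∧
    (∀ i j : Fin (L.length - 1), i < j → ColLT (p.2 i : ℕ × ℕ) (p.2 j : ℕ × ℕ)) ∧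
    (∀ i : Fin (L.length - 1),
      (p.1 (p.2 i) : ℕ) = stepRow (L.getD (i : ℕ) ⊥) (L.getD ((i : ℕ) + 1) ⊥))}

/-- For an unbarred cell `c`, `ρ(c) = ρ⁽ⁱ⁾` where `i` is maximal with `α_i < c` in
column order, i.e. `i` is the number of barred cells preceding `c`. -/
def rhoOf {s : Finset (ℕ × ℕ)} (L : List YoungDiagram)
    (β : Fin (L.length - 1) → s) (c : s) : YoungDiagram :=
  L.getD ((Finset.univ.filter
    (fun i : Fin (L.length - 1) => ColLT (β i : ℕ × ℕ) (c : ℕ × ℕ))).card) ⊥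

/-- The specialized factorial Littlewood–Richardson coefficient
`f^ν_{λμ} = Σ_{T ∈ 𝒯(λ,ν/μ)} ∏_{α unbarred} (ρ(α)_{T(α)} + n − 2 T(α) − c(α) + 1)`,
where `T(α)` is the `1`-based entry and `ρ(α)_{T(α)}` the `T(α)`-th part of `ρ(α)`. -/
noncomputable def fcoef (n : ℕ) (lam μ ν : YoungDiagram) : ℤ :=
  ∑ᶠ L ∈ chainSet μ ν,
    ∑ᶠ p ∈ TSet (n := n) lam.cells L,
      ∏ c : lam.cells,
        if ∃ i, p.2 i = c then 1
        else ((rhoOf L p.2 c).rowLen (p.1 c) : ℤ) + (n : ℤ) - 2 * ((p.1 c : ℤ) + 1)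
              - (((c : ℕ × ℕ).2 : ℤ) - ((c : ℕ × ℕ).1 : ℤ)) + 1

/-- The column Young diagram `(1^n)`. -/
def oneCol (n : ℕ) : YoungDiagram :=
  ⟨Finset.range n ×ˢ Finset.range 1, by
    intro a b hba ha
    simp only [Finset.coe_product, Set.mem_prod, Finset.mem_coe, Finset.mem_range] at ha ⊢
    obtain ⟨h1, h2⟩ := hba
    omega⟩

/-- The Young diagram `(2^r 1^{n-r})` (for `r ≤ n`). -/
def twoOne (n r : ℕ) : YoungDiagram :=
  ⟨Finset.range n ×ˢ Finset.range 1 ∪ Finset.range r ×ˢ Finset.range 2, by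
    intro a b hba ha
    simp only [Finset.coe_union, Finset.coe_product, Set.mem_union, Set.mem_prod,
      Finset.mem_coe, Finset.mem_range] at ha ⊢
    obtain ⟨h1, h2⟩ := hba
    omega⟩

theorem mem_twoOne (n r : ℕ) (x : ℕ × ℕ) :
    x ∈ (twoOne n r).cells ↔ (x.1 < n ∧ x.2 < 1) ∨ (x.1 < r ∧ x.2 < 2) := by
  obtain ⟨a, b⟩ := x
  simp only [twoOne, Finset.mem_union, Finset.mem_product, Finset.mem_range]

theorem mem_oneCol (n : ℕ) (x : ℕ × ℕ) :
    x ∈ (oneCol n).cells ↔ (x.1 < n ∧ x.2 < 1) := by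
  obtain ⟨a, b⟩ := x
  simp only [oneCol, Finset.mem_product, Finset.mem_range]

theorem twoOne_zero (n : ℕ) : twoOne n 0 = oneCol n := by
  ext x
  rw [mem_twoOne, mem_oneCol]
  omega

theorem twoOne_inj (n r s : ℕ) (h : twoOne n r = twoOne n s) : r = s := by
  by_contra hne
  have h1 := mem_twoOne n r (min r s, 1)
  have h2 := mem_twoOne n s (min r s, 1)
  rw [h] at h1
  rw [h1] at h2
  simp only at h2
  omega

theorem twoOne_sdiff (n i : ℕ) :
    (twoOne n (i + 1)).cells \ (twoOne n i).cells = if i < n then {(i, 1)} else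
      ((twoOne n (i + 1)).cells \ (twoOne n i).cells) := by
  split_ifs with hi
  · ext ⟨a, b⟩
    rw [Finset.mem_sdiff, mem_twoOne, mem_twoOne, Finset.mem_singleton, Prod.mk.injEq]
    simp only
    omega
  · rfl

theorem stepRow_twoOne (n i : ℕ) (hi : i < n) :
    stepRow (twoOne n i) (twoOne n (i + 1)) = i := by
  rw [stepRow, twoOne_sdiff, if_pos hi]
  simp

theorem covers_twoOne (n i : ℕ) (hi : i < n) :
    Covers (twoOne n i) (twoOne n (i + 1)) := by
  have hsub : (twoOne n i).cells ⊆ (twoOne n (i + 1)).cells := by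
    intro x hx
    rw [mem_twoOne] at hx ⊢
    omega
  refine ⟨YoungDiagram.cells_subset_iff.1 hsub, ?_⟩
  have h := Finset.card_sdiff_add_card_eq_card hsub
  rw [twoOne_sdiff, if_pos hi, Finset.card_singleton] at h
  show (twoOne n (i + 1)).cells.card = (twoOne n i).cells.card + 1
  omega

/-- Adding a cell to `(2^i 1^{n-i})` in a row `b` with `i ≤ b < n`. -/
theorem step_unique (n i : ℕ) (σ : YoungDiagram) (h : Covers (twoOne n i) σ)
    (h1 : i ≤ stepRow (twoOne n i) σ) (h2 : stepRow (twoOne n i) σ < n) :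
    σ = twoOne n (i + 1) := by
  obtain ⟨hle, hc⟩ := h
  have hsub : (twoOne n i).cells ⊆ σ.cells := YoungDiagram.cells_subset_iff.2 hle
  have hcard := Finset.card_sdiff_add_card_eq_card hsub
  change σ.cells.card = (twoOne n i).cells.card + 1 at hc
  have hone : (σ.cells \ (twoOne n i).cells).card = 1 := by omega
  obtain ⟨⟨a, b⟩, hx⟩ := Finset.card_eq_one.1 hone
  have hs : stepRow (twoOne n i) σ = a := by rw [stepRow, hx]; simp
  rw [hs] at h1 h2
  have hm : ∀ y : ℕ × ℕ, (y ∈ σ.cells ∧ y ∉ (twoOne n i).cells) ↔ y = (a, b) := by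
    intro y
    rw [← Finset.mem_sdiff, hx, Finset.mem_singleton]
  have hab := (hm (a, b)).2 rfl
  have hnab := hab.2
  rw [mem_twoOne] at hnab
  simp only at hnab
  have hb : 1 ≤ b := by omega
  have hi1 : (i, 1) ∈ σ.cells := by
    have := σ.up_left_mem h1 hb ((YoungDiagram.mem_cells _).1 hab.1)
    exact (YoungDiagram.mem_cells _).2 this
  have hi2 : ((i, 1) : ℕ × ℕ) ∉ (twoOne n i).cells := by
    rw [mem_twoOne]; simp
  have he := (hm (i, 1)).1 ⟨hi1, hi2⟩
  rw [Prod.mk.injEq] at he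
  obtain ⟨rfl, rfl⟩ := he
  ext y
  by_cases hy : y ∈ (twoOne n i).cells
  · have := hsub hy
    rw [mem_twoOne] at hy ⊢
    constructor
    · intro _; omega
    · intro _; exact this
  · have h3 := hm y
    have h4 : y ∈ (twoOne n (i + 1)).cells ↔ y = (i, 1) := by
      rw [mem_twoOne] at hy ⊢
      rw [Prod.ext_iff]
      simp only
      omega
    rw [h4, ← h3]
    tauto

/-- The unique chain. -/
def L0 (n r : ℕ) : List YoungDiagram := (List.range (r + 1)).map (twoOne n)

theorem L0_length (n r : ℕ) : (L0 n r).length = r + 1 := by simp [L0]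

theorem L0_getD (n r i : ℕ) (hi : i ≤ r) : (L0 n r).getD i ⊥ = twoOne n i := by
  have : i < (L0 n r).length := by rw [L0_length]; omega
  rw [List.getD_eq_getElem _ _ this]
  simp [L0]

theorem L0_mem (n r : ℕ) (hr : r ≤ n) : L0 n r ∈ chainSet (oneCol n) (twoOne n r) := by
  refine ⟨?_, ?_, ?_⟩
  · show List.IsChain Covers _
    rw [List.isChain_iff_getElem]
    intro i hi
    rw [L0_length] at hi
    simp only [L0, List.getElem_map, List.getElem_range]
    exact covers_twoOne n i (by omega)
  · simp [L0, List.range_succ_eq_map, twoOne_zero]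
  · simp [L0, List.range_succ]

/-- The unique filling is `T(i) = i`. -/
theorem ssyt_unique (n : ℕ) (T : (oneCol n).cells → Fin n) (h : IsSsyt (oneCol n).cells T)
    (c : (oneCol n).cells) : (T c : ℕ) = (c : ℕ × ℕ).1 := by
  let g : Fin n → Fin n := fun i => T ⟨(i, 0), by rw [mem_oneCol]; simp⟩
  have hg : StrictMono g := fun i j hij => h.2 _ _ hij rfl
  obtain ⟨⟨a, b⟩, hc⟩ := c
  have hc' := hc
  rw [mem_oneCol] at hc'
  simp only at hc'
  obtain ⟨ha, hb⟩ := hc'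
  obtain rfl : b = 0 := by omega
  have h1 : (⟨a, ha⟩ : Fin n) ≤ g ⟨a, ha⟩ := hg.le_apply
  have h2 : g ⟨a, ha⟩ ≤ (⟨a, ha⟩ : Fin n) := hg.apply_le
  have h3 := le_antisymm h2 h1
  exact congrArg Fin.val h3

theorem col_lt_row (n : ℕ) (c d : (oneCol n).cells) :
    ColLT c d ↔ (c : ℕ × ℕ).1 < (d : ℕ × ℕ).1 := by
  have h1 := (mem_oneCol n c).1 c.2
  have h2 := (mem_oneCol n d).1 d.2
  unfold ColLT
  omega

theorem le_row (n l : ℕ) (β : Fin l → (oneCol n).cells)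
    (h : ∀ i j : Fin l, i < j → ColLT (β i : ℕ × ℕ) (β j : ℕ × ℕ)) :
    ∀ k, ∀ hk : k < l, k ≤ (β ⟨k, hk⟩ : ℕ × ℕ).1 := by
  intro k
  induction k with
  | zero => intro _; exact Nat.zero_le _
  | succ k ih =>
    intro hk
    have h1 := ih (by omega)
    have h2 := (col_lt_row n _ _).1 (h ⟨k, by omega⟩ ⟨k + 1, hk⟩ (by simp))
    omega

theorem chain_getD (n : ℕ) (nu : YoungDiagram) (L : List YoungDiagram)
    (hL : L ∈ chainSet (oneCol n) nu)
    (p : ((oneCol n).cells → Fin n) × (Fin (L.length - 1) → (oneCol n).cells))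
    (hp : p ∈ TSet (n := n) (oneCol n).cells L) :
    ∀ k, k < L.length → L.getD k ⊥ = twoOne n k := by
  obtain ⟨hch, hhd, hlast⟩ := hL
  obtain ⟨hT, hβ, hrow⟩ := hp
  change List.IsChain Covers L at hch
  rw [List.isChain_iff_getElem] at hch
  intro k
  induction k with
  | zero =>
    intro h0
    rw [List.getD_eq_getElem _ _ h0, twoOne_zero]
    rw [List.head?_eq_getElem?, List.getElem?_eq_getElem h0] at hhd
    exact Option.some.inj hhd
  | succ k ih =>
    intro hk
    have hk' : k < L.length := by omega
    have h1 := ih hk'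
    have hkl : k < L.length - 1 := by omega
    have h2 := hrow ⟨k, hkl⟩
    have h3 := ssyt_unique n p.1 hT (p.2 ⟨k, hkl⟩)
    have h4 := le_row n _ p.2 hβ k hkl
    have h5 := ((mem_oneCol n _).1 (p.2 ⟨k, hkl⟩).2).1
    have h6 := hch k hk
    rw [← List.getD_eq_getElem _ ⊥ hk, ← List.getD_eq_getElem _ ⊥ hk', h1] at h6
    simp only at h2
    rw [h1] at h2
    exact step_unique n k _ h6 (by omega) (by omega)

theorem chain_unique (n : ℕ) (nu : YoungDiagram) (L : List YoungDiagram)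
    (hL : L ∈ chainSet (oneCol n) nu)
    (p : ((oneCol n).cells → Fin n) × (Fin (L.length - 1) → (oneCol n).cells))
    (hp : p ∈ TSet (n := n) (oneCol n).cells L) :
    ∃ r, r ≤ n ∧ nu = twoOne n r ∧ L = L0 n r := by
  have hg := chain_getD n nu L hL p hp
  have hne : L ≠ [] := by
    rintro rfl
    simpa using hL.2.1
  have hpos : 0 < L.length := List.length_pos_iff.2 hne
  refine ⟨L.length - 1, ?_, ?_, ?_⟩
  · rcases Nat.eq_zero_or_pos (L.length - 1) with h0 | h0
    · omega
    · have h4 := le_row n _ p.2 hp.2.1 (L.length - 1 - 1) (by omega)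
      have h5 := ((mem_oneCol n _).1 (p.2 ⟨L.length - 1 - 1, by omega⟩).2).1
      omega
  · have h := hL.2.2
    have hl : L.length - 1 < L.length := by omega
    rw [List.getLast?_eq_getElem?, List.getElem?_eq_getElem hl] at h
    rw [← hg _ hl, List.getD_eq_getElem _ _ hl]
    exact (Option.some.inj h).symm
  · apply List.ext_getElem
    · rw [L0_length]; omega
    · intro i h1 h2
      rw [← List.getD_eq_getElem _ ⊥ h1, ← List.getD_eq_getElem _ ⊥ h2, hg i h1,
        L0_getD n _ i (by omega)]

/-- The unique barred tableau. -/
def p0 (n r : ℕ) (hr : r ≤ n) :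
    ((oneCol n).cells → Fin n) × (Fin ((L0 n r).length - 1) → (oneCol n).cells) :=
  (fun c => ⟨(c : ℕ × ℕ).1, ((mem_oneCol n _).1 c.2).1⟩,
   fun i => ⟨((i : ℕ), 0), (mem_oneCol n _).2
    ⟨by have := i.2; have hl := L0_length n r; simp only; omega, by simp⟩⟩)

theorem p0_mem (n r : ℕ) (hr : r ≤ n) : p0 n r hr ∈ TSet (n := n) (oneCol n).cells (L0 n r) := by
  refine ⟨⟨?_, ?_⟩, ?_, ?_⟩
  · intro c c' h _
    exact le_of_eq (Fin.ext h)
  · intro c c' h _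
    exact h
  · intro i j hij
    exact Or.inr ⟨rfl, hij⟩
  · intro i
    have := i.2
    have hl := L0_length n r
    rw [L0_getD n r i (by omega), L0_getD n r (i + 1) (by omega), stepRow_twoOne n i (by omega)]
    rfl

theorem p0_unique (n r : ℕ) (hr : r ≤ n)
    (p : ((oneCol n).cells → Fin n) × (Fin ((L0 n r).length - 1) → (oneCol n).cells))
    (hp : p ∈ TSet (n := n) (oneCol n).cells (L0 n r)) : p = p0 n r hr := by
  obtain ⟨hT, hβ, hrow⟩ := hp
  refine Prod.ext ?_ ?_
  · funext c
    exact Fin.ext (ssyt_unique n p.1 hT c)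
  · funext i
    have hi := i.2
    have hl := L0_length n r
    have h1 := hrow i
    rw [L0_getD n r i (by omega), L0_getD n r (i + 1) (by omega), stepRow_twoOne n i (by omega),
      ssyt_unique n p.1 hT] at h1
    have h2 := ((mem_oneCol n _).1 (p.2 i).2).2
    refine Subtype.ext (Prod.ext h1 ?_)
    show (p.2 i : ℕ × ℕ).2 = 0
    omega

theorem twoOne_rowLen (n r i : ℕ) (h1 : r ≤ i) (h2 : i < n) : (twoOne n r).rowLen i = 1 := by
  have ha : (i, 0) ∈ twoOne n r := by
    rw [← YoungDiagram.mem_cells, mem_twoOne]; simp; omega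
  have hb : ¬ (i, 1) ∈ twoOne n r := by
    rw [← YoungDiagram.mem_cells, mem_twoOne]; simp; omega
  rw [YoungDiagram.mem_iff_lt_rowLen] at ha hb
  omega

theorem p0_factor (n r : ℕ) (hr : r ≤ n) (c : (oneCol n).cells) :
    (if ∃ i, (p0 n r hr).2 i = c then (1 : ℤ)
        else ((rhoOf (L0 n r) (p0 n r hr).2 c).rowLen ((p0 n r hr).1 c) : ℤ) + (n : ℤ)
          - 2 * (((p0 n r hr).1 c : ℤ) + 1)
              - (((c : ℕ × ℕ).2 : ℤ) - ((c : ℕ × ℕ).1 : ℤ)) + 1)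
    = if (c : ℕ × ℕ).1 < r then 1 else ((n : ℤ) - (c : ℕ × ℕ).1) := by
  have hc := (mem_oneCol n _).1 c.2
  by_cases h : (c : ℕ × ℕ).1 < r
  · rw [if_pos h, if_pos]
    refine ⟨⟨(c : ℕ × ℕ).1, by rw [L0_length]; omega⟩, ?_⟩
    refine Subtype.ext (Prod.ext rfl ?_)
    show 0 = (c : ℕ × ℕ).2
    omega
  · rw [if_neg h, if_neg]
    · have hrho : rhoOf (L0 n r) (p0 n r hr).2 c = twoOne n r := by
        unfold rhoOf
        rw [Finset.filter_true_of_mem, Finset.card_univ, Fintype.card_fin, L0_length,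
          L0_getD n r _ (by omega)]
        · rfl
        · intro i _
          have hi := i.2
          have hl := L0_length n r
          rw [col_lt_row]
          show (i : ℕ) < _
          omega
      have hv : ((p0 n r hr).1 c : ℕ) = (c : ℕ × ℕ).1 := rfl
      rw [hrho, hv, twoOne_rowLen n r _ (by omega) hc.1]
      have : (c : ℕ × ℕ).2 = 0 := by omega
      rw [this]
      push_cast
      ring
    · rintro ⟨i, hi⟩
      apply h
      rw [← hi]
      have := i.2
      have hl := L0_length n r
      show (i : ℕ) < r
      omega

theorem prod_range_fact (n r : ℕ) (hr : r ≤ n) :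
    ∏ i ∈ Finset.range n, (if i < r then (1 : ℤ) else ((n : ℤ) - i)) = ((n - r).factorial : ℤ) := by
  obtain ⟨m, rfl⟩ := Nat.exists_eq_add_of_le hr
  rw [Finset.prod_range_add]
  rw [Finset.prod_eq_one, one_mul, Nat.add_sub_cancel_left]
  · rw [← Finset.prod_range_reflect, ← Finset.prod_range_add_one_eq_factorial]
    push_cast
    apply Finset.prod_congr rfl
    intro i hi
    rw [Finset.mem_range] at hi
    rw [if_neg (by omega)]
    omega
  · intro i hi
    rw [if_pos (Finset.mem_range.1 hi)]

open Classical in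
theorem fcoef_twoOne (n r : ℕ) (hr : r ≤ n) :
    fcoef n (oneCol n) (oneCol n) (twoOne n r) = (Nat.factorial (n - r) : ℤ) := by
  unfold fcoef
  rw [finsum_eq_single _ (L0 n r)]
  · rw [finsum_eq_if, if_pos (L0_mem n r hr), finsum_eq_single _ (p0 n r hr)]
    · rw [finsum_eq_if, if_pos (p0_mem n r hr)]
      rw [Finset.prod_congr rfl (fun c _ => p0_factor n r hr c)]
      rw [Finset.prod_coe_sort (oneCol n).cells
        (fun c : ℕ × ℕ => if c.1 < r then (1 : ℤ) else ((n : ℤ) - c.1))]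
      show ∏ c ∈ Finset.range n ×ˢ Finset.range 1, _ = _
      rw [Finset.prod_product]
      simp only [Finset.prod_range_one]
      exact prod_range_fact n r hr
    · intro p hp
      rw [finsum_eq_if, if_neg]
      intro h
      exact hp (p0_unique n r hr p h)
  · intro L hL
    rw [finsum_eq_if]
    split_ifs with h
    · apply finsum_mem_of_eqOn_zero
      intro p hp
      exfalso
      obtain ⟨s, hs, h1, h2⟩ := chain_unique n _ L h p hp
      rw [← twoOne_inj n r s h1] at h2
      exact hL h2
    · rfl

/-- **Square of the Capelli element:** for `λ = μ = (1^n)`, `f^ν_{λμ}` vanishes unless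
`ν = (2^r 1^{n−r})` for some `0 ≤ r ≤ n`, and `f^{(2^r 1^{n−r})}_{(1^n)(1^n)} = (n−r)!`. -/
theorem capelli_square (n : ℕ) (hn : 1 ≤ n) :
    (∀ nu : YoungDiagram, nu.colLen 0 ≤ n → (¬ ∃ r, r ≤ n ∧ nu = twoOne n r) →
      fcoef n (oneCol n) (oneCol n) nu = 0) ∧
    (∀ r, r ≤ n → fcoef n (oneCol n) (oneCol n) (twoOne n r) =
      (Nat.factorial (n - r) : ℤ)) := by
  refine ⟨?_, fun r hr => fcoef_twoOne n r hr⟩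
  intro nu _ hnu
  unfold fcoef
  apply finsum_mem_of_eqOn_zero
  intro L hL
  apply finsum_mem_of_eqOn_zero
  intro p hp
  exfalso
  obtain ⟨s, hs, h1, _⟩ := chain_unique n nu L hL p hp
  exact hnu ⟨s, hs, h1⟩

end FactorialLR
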